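/- Let Δ, a, b, c be integers with Δ ≥ 2, 1 ≤ a ≤ Δ-1, 0 ≤ b ≤ Δ-a and 0 ≤ c ≤ Δ-a, and set d = min(c+a, Δ-a). Let C be a multiset of Δ nonempty subsets of {M,Z,P,O,X} that is universally closed and maximal for the collection of black configurations of Ψ_Δ(a,b,c). Then C extends to one of the following three multisets of subsets: (a-1 copies of {M,Z,P,O,X}) + (one copy of {M,X}) + (Δ-a copies of {P,O,X}); (a copies of {M,Z,P,O,X}) + (d copies of {P,O,X}) + (Δ-a-d copies of {O,X}); (a copies of {M,Z,P,O,X}) + (one copy of {X}) + (Δ-a-1 copies of {P,O,X}). -/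

import Mathlib

/-- The five-element alphabet {M, Z, P, O, X}. -/
inductive Label5 where
  | M | Z | P | O | X
deriving DecidableEq

open Label5

/-- Black configurations of Ψ_Δ(a,b,c) (they only depend on Δ, a, c). -/
def blackPsi (Δ a c : ℕ) (w : Multiset Label5) : Prop :=
  (∃ s t u, w = s + (t ::ₘ u) ∧ Multiset.card s = a - 1 ∧ (t = M ∨ t = X) ∧
    Multiset.card u = Δ - a ∧ ∀ l ∈ u, l ∈ ({P, O, X} : Finset Label5)) ∨
  (∃ s t u, w = s + t + u ∧ Multiset.card s = a ∧
    Multiset.card t = c ∧ (∀ l ∈ t, l ∈ ({P, O, X} : Finset Label5)) ∧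
    Multiset.card u = Δ - a - c ∧ ∀ l ∈ u, l ∈ ({O, X} : Finset Label5)) ∨
  (∃ s u, w = s + (X ::ₘ u) ∧ Multiset.card s = a ∧
    Multiset.card u = Δ - a - 1 ∧ ∀ l ∈ u, l ∈ ({P, O, X} : Finset Label5))

/-- `C` is universally closed for the collection `B`: every multiset obtained by
choosing one label from each subset in `C` belongs to `B`. -/
def universallyClosed {σ : Type*} (B : Multiset σ → Prop) (C : Multiset (Finset σ)) : Prop :=
  ∀ w : Multiset σ, Multiset.Rel (fun l F => l ∈ F) w C → B w

/-- `C` is maximal for `B`: enlarging one copy of a subset occurring in `C` by a new label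
always destroys universal closedness. -/
def maximalFor {σ : Type*} [DecidableEq σ] (B : Multiset σ → Prop)
    (C : Multiset (Finset σ)) : Prop :=
  ∀ F ∈ C, ∀ l ∉ F, ¬ universallyClosed B (insert l F ::ₘ C.erase F)

/-- A black configuration has at most `a` labels in `{M, Z}`, and if it avoids both `M` and `X`,
it has at most `a + c` labels in `{Z, P}`. -/
theorem blackPsi.countP_le {Δ a c : ℕ} {w : Multiset Label5} (ha : 1 ≤ a)
    (h : blackPsi Δ a c w) :
    w.countP (fun l => l = M ∨ l = Z) ≤ a ∧
      (M ∈ w ∨ X ∈ w ∨ w.countP (fun l => l = Z ∨ l = P) ≤ a + c) := by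
  have hMZ : ∀ u : Multiset Label5, (∀ l ∈ u, l ∈ ({P, O, X} : Finset Label5)) →
      u.countP (fun l => l = M ∨ l = Z) = 0 := by
    intro u hu
    refine Multiset.countP_eq_zero.2 fun l hl => ?_
    have := hu l hl
    revert this
    cases l <;> simp
  rcases h with ⟨s, t, u, rfl, hs, ht, -, hu⟩ | ⟨s, t, u, rfl, hs, ht, htP, -, huO⟩ |
    ⟨s, u, rfl, hs, -, hu⟩
  · have h1 := hMZ u hu
    have h2 := Multiset.countP_le_card (fun l => l = M ∨ l = Z) s
    refine ⟨?_, by rcases ht with rfl | rfl <;> simp⟩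
    rw [Multiset.countP_add, Multiset.countP_cons]
    split_ifs <;> omega
  · have h1 := hMZ t htP
    have h2 := hMZ u fun l hl => by
      have := huO l hl
      revert this
      cases l <;> simp
    have h3 := Multiset.countP_le_card (fun l => l = M ∨ l = Z) s
    have h4 := Multiset.countP_le_card (fun l => l = Z ∨ l = P) s
    have h5 := Multiset.countP_le_card (fun l => l = Z ∨ l = P) t
    have h6 : u.countP (fun l => l = Z ∨ l = P) = 0 := by
      refine Multiset.countP_eq_zero.2 fun l hl => ?_
      have := huO l hl
      revert this
      cases l <;> simp
    simp only [Multiset.countP_add]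
    exact ⟨by omega, .inr (.inr (by omega))⟩
  · have h1 := hMZ u hu
    have h2 := Multiset.countP_le_card (fun l => l = M ∨ l = Z) s
    refine ⟨?_, by simp⟩
    rw [Multiset.countP_add, Multiset.countP_cons, if_neg (by simp)]
    omega

/-- A multiset with at most `k` elements satisfying `p` splits off a part of size `k`
containing all of them. -/
theorem Multiset.exists_add_of_countP_le {α : Type*} (p : α → Prop) [DecidablePred p]
    {C : Multiset α} {k : ℕ} (h : C.countP p ≤ k) (hk : k ≤ C.card) :
    ∃ S T, C = S + T ∧ S.card = k ∧ T.card = C.card - k ∧ ∀ x ∈ T, ¬ p x := by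
  have h1 := C.card_eq_countP_add_countP p
  obtain ⟨T, hT, hTc⟩ : ∃ T ≤ C.filter (fun x => ¬ p x), T.card = C.card - k := by
    have hcard : C.card - k ≤ (C.filter (fun x => ¬ p x)).card := by
      rw [← Multiset.countP_eq_card_filter]
      omega
    have hpos := Nat.choose_pos hcard
    rw [← Multiset.card_powersetCard, Multiset.card_pos_iff_exists_mem] at hpos
    simpa only [Multiset.mem_powersetCard] using hpos
  obtain ⟨S, hS⟩ := Multiset.le_iff_exists_add.1 (hT.trans (Multiset.filter_le _ _))
  refine ⟨S, T, hS.trans (add_comm _ _), ?_, hTc, fun x hx =>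
    (Multiset.mem_filter.1 (Multiset.mem_of_le hT hx)).2⟩
  have := congrArg Multiset.card hS
  rw [Multiset.card_add] at this
  omega

/-- A choice function on `C` yields a member of every collection for which `C` is
universally closed. -/
theorem universallyClosed.map {σ : Type*} {B : Multiset σ → Prop} {C : Multiset (Finset σ)}
    (h : universallyClosed B C) {f : Finset σ → σ} (hf : ∀ F ∈ C, f F ∈ F) :
    B (C.map f) :=
  h _ (Multiset.rel_map_left.2 (Multiset.rel_refl_of_refl_on hf))

/-- Every set is contained in the full alphabet. -/
theorem Label5.subset_full (F : Finset Label5) : F ⊆ {M, Z, P, O, X} := by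
  intro l _
  cases l <;> simp

/-- A set avoiding `M` and `Z` is contained in `{P, O, X}`. -/
theorem Label5.subset_POX {F : Finset Label5} (h : ¬ (M ∈ F ∨ Z ∈ F)) : F ⊆ {P, O, X} := by
  intro l hl
  cases l <;> simp_all

/-- A multiset of sets, at most `k` of which meet `{M, Z}`, extends to `k` full sets together
with copies of `{P, O, X}`. -/
theorem Label5.rel_full_add_POX {C : Multiset (Finset Label5)} {k n : ℕ}
    (h : C.countP (fun F => M ∈ F ∨ Z ∈ F) ≤ k) (hC : C.card = k + n) :
    Multiset.Rel (· ⊆ ·) C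
      (Multiset.replicate k ({M, Z, P, O, X} : Finset Label5) +
        Multiset.replicate n ({P, O, X} : Finset Label5)) := by
  obtain ⟨S, T, rfl, hS, hT, hTp⟩ := Multiset.exists_add_of_countP_le _ h (by omega)
  exact .add (Multiset.rel_replicate_right.2 ⟨hS, fun F _ => subset_full F⟩)
    (Multiset.rel_replicate_right.2 ⟨by omega, fun F hF => subset_POX (hTp F hF)⟩)

theorem stmt0 (Δ a b c : ℕ) (hΔ : 2 ≤ Δ) (ha1 : 1 ≤ a) (ha2 : a ≤ Δ - 1)
    (hb : b ≤ Δ - a) (hc : c ≤ Δ - a)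
    (C : Multiset (Finset Label5)) (hcard : Multiset.card C = Δ)
    (hne : ∀ F ∈ C, F.Nonempty)
    (hclosed : universallyClosed (blackPsi Δ a c) C)
    (hmax : maximalFor (blackPsi Δ a c) C) :
    Multiset.Rel (· ⊆ ·) C
      (Multiset.replicate (a - 1) ({M, Z, P, O, X} : Finset Label5) +
        (({M, X} : Finset Label5) ::ₘ
          Multiset.replicate (Δ - a) ({P, O, X} : Finset Label5))) ∨
    Multiset.Rel (· ⊆ ·) C
      (Multiset.replicate a ({M, Z, P, O, X} : Finset Label5) +
        Multiset.replicate (min (c + a) (Δ - a)) ({P, O, X} : Finset Label5) +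
        Multiset.replicate (Δ - a - min (c + a) (Δ - a)) ({O, X} : Finset Label5)) ∨
    Multiset.Rel (· ⊆ ·) C
      (Multiset.replicate a ({M, Z, P, O, X} : Finset Label5) +
        (({X} : Finset Label5) ::ₘ
          Multiset.replicate (Δ - a - 1) ({P, O, X} : Finset Label5))) := by
  have hMZ : C.countP (fun F => M ∈ F ∨ Z ∈ F) ≤ a := by
    let f : Finset Label5 → Label5 := fun F =>
      if M ∈ F then M else if Z ∈ F then Z else if h : F.Nonempty then h.choose else X
    have hf : ∀ F ∈ C, f F ∈ F := fun F hF => by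
      simp only [f, dif_pos (hne F hF)]
      split_ifs with h1 h2
      exacts [h1, h2, (hne F hF).choose_spec]
    refine le_trans ?_ ((hclosed.map hf).countP_le ha1).1
    rw [Multiset.countP_map, Multiset.countP_eq_card_filter]
    refine Multiset.card_le_card (Multiset.monotone_filter_right _ fun F hF => ?_)
    by_cases h1 : M ∈ F
    · simp [f, h1]
    · simp_all [f]
  by_cases hMX : ∃ F ∈ C, F ⊆ {M, X}
  · obtain ⟨F, hF, hFs⟩ := hMX
    obtain ⟨D, rfl⟩ := Multiset.exists_cons_of_mem hF
    rw [Multiset.card_cons] at hcard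
    by_cases hM : M ∈ F
    · left
      rw [Multiset.countP_cons_of_pos _ (.inl hM)] at hMZ
      rw [Multiset.add_cons]
      exact .cons hFs (Label5.rel_full_add_POX (by omega) (by omega))
    · right; right
      have hFX : F ⊆ {X} := fun l hl => by
        have := hFs hl
        cases l <;> first | contradiction | simp at this ⊢
      have hle := Multiset.countP_le_of_le (fun F => M ∈ F ∨ Z ∈ F) (Multiset.le_cons_self D F)
      rw [Multiset.add_cons]
      exact .cons hFX (Label5.rel_full_add_POX (by omega) (by omega))
  · right; left
    push Not at hMX
    have hZP : C.countP (fun F => Z ∈ F ∨ P ∈ F) ≤ a + c := by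
      let f : Finset Label5 → Label5 := fun F => if Z ∈ F then Z else if P ∈ F then P else O
      have hf : ∀ F ∈ C, f F ∈ F := fun F hF => by
        simp only [f]
        split_ifs with h1 h2
        · exact h1
        · exact h2
        · by_contra hO
          refine hMX F hF fun l hl => ?_
          cases l <;> first | contradiction | simp
      have hfMX : ∀ F, f F ≠ M ∧ f F ≠ X := fun F => by
        simp only [f]
        split_ifs <;> simp
      rcases ((hclosed.map hf).countP_le ha1).2 with h | h | h
      · obtain ⟨F, -, hF⟩ := Multiset.mem_map.1 h
        exact absurd hF (hfMX F).1
      · obtain ⟨F, -, hF⟩ := Multiset.mem_map.1 h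
        exact absurd hF (hfMX F).2
      · refine le_trans ?_ h
        rw [Multiset.countP_map, Multiset.countP_eq_card_filter]
        refine Multiset.card_le_card (Multiset.monotone_filter_right _ fun F hF => ?_)
        by_cases h1 : Z ∈ F
        · simp [f, h1]
        · simp_all [f]
    obtain ⟨S, U, rfl, hS, hU, hUp⟩ := Multiset.exists_add_of_countP_le _ hMZ (by omega)
    have hUP : U.countP (fun F => Z ∈ F ∨ P ∈ F) ≤ min (c + a) (Δ - a) := by
      have h1 := U.countP_le_card (fun F => Z ∈ F ∨ P ∈ F)
      rw [Multiset.countP_add] at hZP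
      omega
    obtain ⟨T, V, rfl, hT, hV, hVp⟩ := Multiset.exists_add_of_countP_le _ hUP (by omega)
    rw [add_assoc]
    refine .add (Multiset.rel_replicate_right.2 ⟨hS, fun F _ => Label5.subset_full F⟩)
      (.add (Multiset.rel_replicate_right.2 ⟨hT, fun F hF =>
          Label5.subset_POX (hUp F (Multiset.mem_add.2 (.inl hF)))⟩)
        (Multiset.rel_replicate_right.2 ⟨by omega, fun F hF l hl => ?_⟩))
    have h1 := hUp F (Multiset.mem_add.2 (.inr hF))
    have h2 := hVp F hF
    push Not at h1 h2
    obtain ⟨hM, hZ⟩ := h1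
    have hP := h2.2
    cases l <;> first | contradiction | simp
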